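/- Let $n$ be a positive integer and let $t$ be a real number with $0 < t < 1$. Then $\sum_{k=1}^{\infty} \frac{H_{k-1} t^k}{k^2 \binom{n+k}{k}} = \zeta(3) - \mathrm{Li}_3(1-t) - \frac{1}{2}\log^2(1-t) \sum_{k=1}^{n} \frac{1}{k}\Big(\frac{t-1}{t}\Big)^k + \big(\zeta(2) - \mathrm{Li}_2(t)\big)\log(1-t) + \log(1-t) \sum_{k=1}^{n} \frac{H_k}{k}\Big(\frac{t-1}{t}\Big)^k - \sum_{p=0}^{n-1} \Big\{ \sum_{k=1}^{n-p} \Big( \frac{H_{p+k} - H_k}{(p+k)k} + \frac{1}{k^2(p+k)} \Big) \Big\} \Big(\frac{t-1}{t}\Big)^p - \frac{1}{2}\log t \log^2(1-t)$. -/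

import Mathlib

/-- The `n`-th harmonic number `H_n = ∑_{k=1}^n 1/k`, with `H_0 = 0`. -/
noncomputable def H (n : ℕ) : ℝ := ∑ i ∈ Finset.range n, (1 : ℝ) / (i + 1)

/-- The dilogarithm function `Li₂(x) = ∑_{k=1}^∞ x^k/k²`. -/
noncomputable def Li2 (x : ℝ) : ℝ := ∑' k : ℕ, x ^ (k + 1) / ((k : ℝ) + 1) ^ 2

/-- The trilogarithm function `Li₃(x) = ∑_{k=1}^∞ x^k/k³`. -/
noncomputable def Li3 (x : ℝ) : ℝ := ∑' k : ℕ, x ^ (k + 1) / ((k : ℝ) + 1) ^ 3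

/-- `ζ(2) = ∑_{k=1}^∞ 1/k²`, the value of the Riemann zeta function at 2. -/
noncomputable def zeta2 : ℝ := ∑' k : ℕ, (1 : ℝ) / ((k : ℝ) + 1) ^ 2

/-- `ζ(3) = ∑_{k=1}^∞ 1/k³`, the value of the Riemann zeta function at 3. -/
noncomputable def zeta3 : ℝ := ∑' k : ℕ, (1 : ℝ) / ((k : ℝ) + 1) ^ 3


open Filter Topology

lemma H_succ' (k : ℕ) : H (k+1) = H k + 1 / ((k:ℝ)+1) := by
  simp [H, Finset.sum_range_succ]

lemma H_zero' : H 0 = 0 := by simp [H]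

lemma H_nonneg' (k : ℕ) : 0 ≤ H k := by
  unfold H; positivity

lemma H_le' (k : ℕ) : H k ≤ k := by
  induction k with
  | zero => simp [H_zero']
  | succ k ih =>
    rw [H_succ']
    have : 1 / ((k:ℝ)+1) ≤ 1 := by
      rw [div_le_one (by positivity)]; linarith [(Nat.cast_nonneg k : (0:ℝ) ≤ k)]
    push_cast; linarith

lemma summ_aux (r : ℝ) (h0 : 0 ≤ r) (h1 : r < 1) : Summable (fun k : ℕ => ((k:ℝ)+1) * r ^ k) := by
  have h := summable_pow_mul_geometric_of_norm_lt_one (R := ℝ) 1 (r := r) (by rw [Real.norm_eq_abs, abs_of_nonneg h0]; exact h1)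
  have h2 := summable_geometric_of_lt_one h0 h1
  refine (h.add h2).congr ?_
  intro k; ring

lemma summ_a (a : ℕ → ℝ) (ha : ∀ k, |a k| ≤ k + 1) (x : ℝ) (hx : |x| < 1) :
    Summable (fun k : ℕ => a k * x ^ k) := by
  refine Summable.of_norm_bounded (summ_aux |x| (abs_nonneg x) hx) ?_
  intro k
  rw [norm_mul, norm_pow, Real.norm_eq_abs, Real.norm_eq_abs]
  exact mul_le_mul_of_nonneg_right (ha k) (by positivity)

lemma deriv_gen (a : ℕ → ℝ) (ha : ∀ k, |a k| ≤ k + 1) (x : ℝ) (hx : |x| < 1) :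
    HasDerivAt (fun y => ∑' k : ℕ, a k * y ^ (k+1) / ((k:ℝ)+1)) (∑' k : ℕ, a k * x ^ k) x := by
  obtain ⟨r, hr1, hr2⟩ := exists_between hx
  have hr0 : 0 ≤ r := (abs_nonneg x).trans hr1.le
  refine hasDerivAt_tsum_of_isPreconnected (𝕜 := ℝ) (F := ℝ)
    (g := fun (k : ℕ) (y : ℝ) => a k * y ^ (k+1) / ((k:ℝ)+1))
    (g' := fun (k : ℕ) (y : ℝ) => a k * y ^ k) (t := Set.Ioo (-r) r) (y₀ := 0)
    (summ_aux r hr0 hr2) isOpen_Ioo isPreconnected_Ioo ?_ ?_ ?_ ?_ ?_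
  · intro k y hy
    have h := ((hasDerivAt_pow (k+1) y).const_mul (a k)).div_const ((k:ℝ)+1)
    refine h.congr_deriv ?_
    have : (k:ℝ)+1 ≠ 0 := by positivity
    push_cast
    field_simp
  · intro k y hy
    rw [norm_mul, norm_pow, Real.norm_eq_abs, Real.norm_eq_abs]
    have hy' : |y| ≤ r := abs_le.2 ⟨hy.1.le, hy.2.le⟩
    exact mul_le_mul (ha k) (pow_le_pow_left₀ (abs_nonneg y) hy' k) (by positivity) (by positivity)
  · constructor <;> linarith [abs_nonneg x]
  · simp
  · exact abs_lt.1 hr1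

/-- logarithm series -/
lemma K0_sum (t : ℝ) (ht : |t| < 1) :
    HasSum (fun k : ℕ => t ^ (k+1) / ((k:ℝ)+1)) (-Real.log (1-t)) :=
  Real.hasSum_pow_div_log_of_abs_lt_one ht

lemma Hgen (t : ℝ) (ht : |t| < 1) : (1-t) * ∑' k : ℕ, H k * t ^ k = - Real.log (1-t) := by
  have hs : Summable (fun k : ℕ => H k * t ^ k) := summ_a H (fun k => by
    rw [abs_of_nonneg (H_nonneg' k)]; linarith [H_le' k]) t ht
  have h1 := hs.tsum_eq_zero_add
  have hK := (K0_sum t ht)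
  have h2 : ∑' k : ℕ, H (k+1) * t^(k+1) = t * ∑' k : ℕ, H k * t ^ k + (-Real.log (1-t)) := by
    rw [← hK.tsum_eq, ← tsum_mul_left, ← (hs.mul_left t).tsum_add hK.summable]
    refine tsum_congr fun k => ?_
    rw [H_succ']; ring
  rw [h2, H_zero'] at h1
  linarith

lemma const_of_deriv (f : ℝ → ℝ) (c : ℝ) (h : ∀ x ∈ Set.Ioo (0:ℝ) 1, HasDerivAt f 0 x)
    (hl : Tendsto f (𝓝[>] 0) (𝓝 c)) (t : ℝ) (ht : t ∈ Set.Ioo (0:ℝ) 1) : f t = c := by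
  have hc : ∀ x ∈ Set.Ioo (0:ℝ) 1, f x = f t := by
    intro x hx
    refine isOpen_Ioo.is_const_of_deriv_eq_zero isPreconnected_Ioo
      (fun y hy => (h y hy).differentiableAt.differentiableWithinAt) (fun y hy => (h y hy).deriv) hx ht
  have : Tendsto f (𝓝[>] 0) (𝓝 (f t)) := by
    refine tendsto_const_nhds.congr' ?_
    filter_upwards [Ioo_mem_nhdsGT (zero_lt_one (α := ℝ))] with x hx
    exact (hc x hx).symm
  exact tendsto_nhds_unique this hl

lemma G0_eq (t : ℝ) (ht : t ∈ Set.Ioo (0:ℝ) 1) :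
    ∑' k : ℕ, H k * t ^ (k+1) / ((k:ℝ)+1) = Real.log (1-t) ^ 2 / 2 := by
  have hH : ∀ k, |H k| ≤ (k:ℝ)+1 := fun k => by
    rw [abs_of_nonneg (H_nonneg' k)]; linarith [H_le' k]
  have key := const_of_deriv (fun y => (∑' k : ℕ, H k * y ^ (k+1) / ((k:ℝ)+1)) - Real.log (1-y) ^ 2 / 2) 0 ?_ ?_ t ht
  · linarith
  · intro x hx
    have hx' : |x| < 1 := abs_lt.2 ⟨by linarith [hx.1], hx.2⟩
    have h1 : (1 - x) ≠ 0 := by linarith [hx.2]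
    have d1 := deriv_gen H hH x hx'
    have d2 := ((((hasDerivAt_id x).const_sub 1).log h1).pow 2).div_const 2
    refine (d1.sub d2).congr_deriv ?_
    have := Hgen x hx'
    simp only [id, Nat.cast_ofNat, Nat.add_one_sub_one, pow_one]
    field_simp
    linear_combination this
  · have d1 := (deriv_gen H hH 0 (by simp)).continuousAt
    have d2 : ContinuousAt (fun y : ℝ => Real.log (1-y) ^ 2 / 2) 0 := by
      have : (1 - (0:ℝ)) ≠ 0 := by norm_num
      fun_prop (disch := assumption)
    have := (d1.tendsto.sub d2.tendsto).mono_left (nhdsWithin_le_nhds (s := Set.Ioi 0))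
    simpa using this

lemma deriv_Li2 (x : ℝ) (hx : x ∈ Set.Ioo (0:ℝ) 1) : HasDerivAt Li2 (-Real.log (1-x) / x) x := by
  have hx' : |x| < 1 := abs_lt.2 ⟨by linarith [hx.1], hx.2⟩
  have hx0 : x ≠ 0 := hx.1.ne'
  have d := deriv_gen (fun k => 1 / ((k:ℝ)+1)) (fun k => by
    rw [abs_of_nonneg (by positivity), div_le_iff₀ (by positivity)]
    nlinarith [(Nat.cast_nonneg k : (0:ℝ) ≤ k)]) x hx'
  convert d using 1
  · funext y; unfold Li2; refine tsum_congr fun k => ?_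
    field_simp
  · rw [← (K0_sum x hx').tsum_eq, ← tsum_div_const]
    refine tsum_congr fun k => ?_
    field_simp
    ring

lemma deriv_Li3 (x : ℝ) (hx : x ∈ Set.Ioo (0:ℝ) 1) : HasDerivAt Li3 (Li2 x / x) x := by
  have hx' : |x| < 1 := abs_lt.2 ⟨by linarith [hx.1], hx.2⟩
  have hx0 : x ≠ 0 := hx.1.ne'
  have d := deriv_gen (fun k => 1 / ((k:ℝ)+1)^2) (fun k => by
    rw [abs_of_nonneg (by positivity), div_le_iff₀ (by positivity)]
    have : (0:ℝ) ≤ k := Nat.cast_nonneg k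
    have : 1 ≤ ((k:ℝ)+1)^3 := one_le_pow₀ (by linarith)
    linarith) x hx'
  convert d using 1
  · funext y; unfold Li3; refine tsum_congr fun k => ?_
    field_simp
  · unfold Li2
    rw [← tsum_div_const]
    refine tsum_congr fun k => ?_
    field_simp
    ring

lemma deriv_F0 (x : ℝ) (hx : x ∈ Set.Ioo (0:ℝ) 1) :
    HasDerivAt (fun y => ∑' k : ℕ, H k * y ^ (k+1) / ((k:ℝ)+1)^2) (Real.log (1-x)^2 / 2 / x) x := by
  have hx' : |x| < 1 := abs_lt.2 ⟨by linarith [hx.1], hx.2⟩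
  have hx0 : x ≠ 0 := hx.1.ne'
  have d := deriv_gen (fun k => H k / ((k:ℝ)+1)) (fun k => by
    have := H_nonneg' k
    have := H_le' k
    rw [abs_of_nonneg (by positivity), div_le_iff₀ (by positivity)]
    nlinarith [(Nat.cast_nonneg k : (0:ℝ) ≤ k)]) x hx'
  convert d using 1
  · funext y; refine tsum_congr fun k => ?_
    field_simp
  · rw [← G0_eq x hx, ← tsum_div_const]
    refine tsum_congr fun k => ?_
    field_simp
    ring

lemma summ_zeta (s : ℕ) (hs : 1 < s) : Summable (fun k : ℕ => 1 / ((k:ℝ)+1)^s) := by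
  have := (summable_nat_add_iff 1).2 (Real.summable_one_div_nat_pow.2 hs)
  simpa using this

lemma contOn_Li (s : ℕ) (hs : 1 < s) :
    ContinuousOn (fun x : ℝ => ∑' k : ℕ, x ^ (k+1) / ((k:ℝ)+1)^s) (Set.Icc 0 1) := by
  refine continuousOn_tsum (fun k => by fun_prop) (summ_zeta s hs) ?_
  intro k x hx
  rw [norm_div, norm_pow, norm_pow, Real.norm_eq_abs, Real.norm_eq_abs, abs_of_nonneg hx.1,
    abs_of_nonneg (by positivity : (0:ℝ) ≤ (k:ℝ)+1)]
  gcongr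
  exact pow_le_one₀ hx.1 hx.2

lemma tend_Li_one (s : ℕ) (hs : 1 < s) :
    Tendsto (fun y : ℝ => ∑' k : ℕ, (1-y) ^ (k+1) / ((k:ℝ)+1)^s) (𝓝[>] 0)
      (𝓝 (∑' k : ℕ, 1 / ((k:ℝ)+1)^s)) := by
  have h := contOn_Li s hs 1 (by simp)
  have h2 : Tendsto (fun y : ℝ => 1 - y) (𝓝[>] 0) (𝓝[Set.Icc 0 1] 1) := by
    refine tendsto_nhdsWithin_iff.2 ⟨?_, ?_⟩
    · have : Tendsto (fun y : ℝ => 1 - y) (𝓝 0) (𝓝 (1 - 0)) := by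
        exact tendsto_const_nhds.sub tendsto_id
      simpa using this.mono_left nhdsWithin_le_nhds
    · filter_upwards [Ioo_mem_nhdsGT (zero_lt_one (α := ℝ))] with x hx
      constructor <;> linarith [hx.1, hx.2]
  have h3 := h.tendsto.comp h2
  simp only [one_pow] at h3
  exact h3

lemma tend_gen (a : ℕ → ℝ) (ha : ∀ k, |a k| ≤ k + 1) :
    Tendsto (fun y : ℝ => ∑' k : ℕ, a k * y ^ (k+1) / ((k:ℝ)+1)) (𝓝[>] 0) (𝓝 0) := by
  have := (deriv_gen a ha 0 (by simp)).continuousAt.tendsto.mono_left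
    (nhdsWithin_le_nhds (s := Set.Ioi 0))
  simpa using this

lemma tend_log1 : Tendsto (fun y : ℝ => Real.log (1-y)) (𝓝[>] 0) (𝓝 0) := by
  have d2 : ContinuousAt (fun y : ℝ => Real.log (1-y)) 0 := by
    have : (1 - (0:ℝ)) ≠ 0 := by norm_num
    fun_prop (disch := assumption)
  simpa using d2.tendsto.mono_left (nhdsWithin_le_nhds (s := Set.Ioi 0))

lemma tend_loglog : Tendsto (fun y : ℝ => Real.log y * Real.log (1-y)) (𝓝[>] 0) (𝓝 0) := by
  have h1 : HasDerivAt (fun y : ℝ => Real.log (1-y)) (-1) 0 := by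
    have := ((hasDerivAt_id (0:ℝ)).const_sub 1).log (by norm_num)
    simpa using this
  have h2 := h1.tendsto_slope.mono_left (nhdsWithin_mono 0 (fun y (hy : y ∈ Set.Ioi (0:ℝ)) => (ne_of_gt hy : y ≠ 0)))
  have h3 : Tendsto (fun y : ℝ => Real.log y * y) (𝓝[>] 0) (𝓝 0) := by
    simpa using tendsto_log_mul_rpow_nhdsGT_zero (r := 1) one_pos
  have h4 := h3.mul h2
  simp only [zero_mul] at h4
  refine h4.congr' ?_
  filter_upwards [self_mem_nhdsWithin] with y hy
  have : y ≠ 0 := ne_of_gt hy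
  simp [slope_def_field]
  field_simp

lemma tend_Li2_zero : Tendsto Li2 (𝓝[>] 0) (𝓝 0) := by
  have h := tend_gen (fun k => 1 / ((k:ℝ)+1)) (fun k => by
    rw [abs_of_nonneg (by positivity), div_le_iff₀ (by positivity)]
    nlinarith [(Nat.cast_nonneg k : (0:ℝ) ≤ k)])
  refine h.congr fun y => ?_
  unfold Li2; refine tsum_congr fun k => ?_
  field_simp

lemma one_sub_mem {x : ℝ} (hx : x ∈ Set.Ioo (0:ℝ) 1) : 1 - x ∈ Set.Ioo (0:ℝ) 1 :=
  ⟨by linarith [hx.2], by linarith [hx.1]⟩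

lemma Li2_refl (t : ℝ) (ht : t ∈ Set.Ioo (0:ℝ) 1) :
    Li2 t + Li2 (1-t) + Real.log t * Real.log (1-t) = zeta2 := by
  refine const_of_deriv (fun t => Li2 t + Li2 (1-t) + Real.log t * Real.log (1-t)) zeta2 ?_ ?_ t ht
  · intro x hx
    have hx0 : x ≠ 0 := hx.1.ne'
    have h1 : (1 - x) ≠ 0 := by linarith [hx.2]
    have d0 := (hasDerivAt_id x).const_sub 1
    have d1 := (deriv_Li2 (1-x) (one_sub_mem hx)).comp x d0
    have d2 := (Real.hasDerivAt_log hx0).mul (d0.log h1)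
    refine (((deriv_Li2 x hx).add d1).add d2).congr_deriv ?_
    simp only [id, sub_sub_cancel]
    field_simp
    ring
  · have := (tend_Li2_zero.add (tend_Li_one 2 (by norm_num))).add tend_loglog
    simpa [zeta2, Li2] using this

lemma F0_eq (t : ℝ) (ht : t ∈ Set.Ioo (0:ℝ) 1) :
    ∑' k : ℕ, H k * t ^ (k+1) / ((k:ℝ)+1)^2 = zeta3 - Li3 (1-t) +
      (zeta2 - Li2 t) * Real.log (1-t) - 1/2 * Real.log t * Real.log (1-t)^2 := by
  have key := const_of_deriv (fun t => (∑' k : ℕ, H k * t ^ (k+1) / ((k:ℝ)+1)^2) + Li3 (1-t) -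
      (zeta2 - Li2 t) * Real.log (1-t) + 1/2 * (Real.log t * Real.log (1-t)^2)) zeta3 ?_ ?_ t ht
  · linarith
  · intro x hx
    have hx0 : x ≠ 0 := hx.1.ne'
    have h1 : (1 - x) ≠ 0 := by linarith [hx.2]
    have d0 := (hasDerivAt_id x).const_sub 1
    have d1 := (deriv_Li3 (1-x) (one_sub_mem hx)).comp x d0
    have d2 := (Real.hasDerivAt_log hx0).mul ((d0.log h1).pow 2)
    have d3 := ((deriv_Li2 x hx).const_sub zeta2).mul (d0.log h1)
    refine ((((deriv_F0 x hx).add d1).sub d3).add (d2.const_mul (1/2))).congr_deriv ?_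
    have := Li2_refl x hx
    have h3 : Li2 (1-x) = zeta2 - Li2 x - Real.log x * Real.log (1-x) := by linarith
    simp only [id, h3, Pi.pow_apply, Nat.cast_ofNat, Nat.add_one_sub_one, pow_one]
    field_simp
    ring
  · have hF := tend_gen (fun k => H k / ((k:ℝ)+1)) (fun k => by
      have := H_nonneg' k
      have := H_le' k
      rw [abs_of_nonneg (by positivity), div_le_iff₀ (by positivity)]
      nlinarith [(Nat.cast_nonneg k : (0:ℝ) ≤ k)])
    have hF' : Tendsto (fun t : ℝ => ∑' k : ℕ, H k * t ^ (k+1) / ((k:ℝ)+1)^2) (𝓝[>] 0) (𝓝 0) := by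
      refine hF.congr fun y => ?_
      refine tsum_congr fun k => ?_
      field_simp
    have := ((hF'.add (tend_Li_one 3 (by norm_num))).sub
      ((tend_Li2_zero.const_sub zeta2).mul tend_log1)).add ((tend_loglog.mul tend_log1).const_mul (1/2))
    have e : zeta3 = 0 + (∑' k : ℕ, 1 / ((k:ℝ)+1)^3) - (zeta2 - 0) * 0 + 1/2 * (0 * 0) := by
      simp [zeta3]
    rw [e]
    refine this.congr fun y => ?_
    unfold Li3
    ring

/-! ### Recurrences in n -/

noncomputable def Cb (n k : ℕ) : ℝ := (Nat.choose (n + (k + 1)) (k + 1) : ℝ)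

lemma Cb_pos (n k : ℕ) : 1 ≤ Cb n k := by
  unfold Cb
  exact_mod_cast Nat.choose_pos (by omega)

lemma Cb_zero (k : ℕ) : Cb 0 k = 1 := by simp [Cb]

lemma Cb_A (n k : ℕ) : Cb n k * ((n:ℝ)+k+2) = Cb (n+1) k * ((n:ℝ)+1) := by
  have h := Nat.choose_mul_succ_eq (n + (k+1)) (k+1)
  have e : n + (k+1) + 1 - (k+1) = n+1 := by omega
  rw [e] at h
  unfold Cb
  rw [show n + 1 + (k+1) = n + (k+1) + 1 by ring]
  have h' : ((Nat.choose (n + (k+1)) (k+1) : ℝ)) * (((n + (k+1) + 1 : ℕ) : ℝ)) =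
    ((Nat.choose (n + (k+1) + 1) (k+1) : ℝ)) * (((n + 1 : ℕ) : ℝ)) := by exact_mod_cast h
  push_cast at h'
  linear_combination h'

lemma Cb_D (n k : ℕ) : Cb n (k+1) * ((k:ℝ)+2) = Cb (n+1) k * ((n:ℝ)+1) := by
  have h := Nat.choose_succ_right_eq (n + 1 + (k+1)) (k+1)
  have e : n + 1 + (k+1) - (k+1) = n+1 := by omega
  rw [e] at h
  unfold Cb
  rw [show n + (k+1+1) = n + 1 + (k+1) by ring]
  have h' : ((Nat.choose (n + 1 + (k+1)) (k+1+1) : ℝ)) * (((k+1 + 1 : ℕ) : ℝ)) =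
    ((Nat.choose (n + 1 + (k+1)) (k+1) : ℝ)) * (((n + 1 : ℕ) : ℝ)) := by exact_mod_cast h
  push_cast at h'
  linear_combination h'


noncomputable def KK (t : ℝ) (n : ℕ) : ℝ := ∑' k : ℕ, t ^ (k+1) / (((k:ℝ)+1) * Cb n k)
noncomputable def GG (t : ℝ) (n : ℕ) : ℝ := ∑' k : ℕ, H k * t ^ (k+1) / (((k:ℝ)+1) * Cb n k)
noncomputable def FF (t : ℝ) (n : ℕ) : ℝ := ∑' k : ℕ, H k * t ^ (k+1) / (((k:ℝ)+1)^2 * Cb n k)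

lemma summ_bd (t : ℝ) (ht : t ∈ Set.Ioo (0:ℝ) 1) (b : ℕ → ℝ) (hb : ∀ k, |b k| ≤ 1) :
    Summable (fun k : ℕ => b k * t ^ (k+1)) := by
  refine Summable.of_norm_bounded
    ((summable_nat_add_iff 1).2 (summable_geometric_of_lt_one ht.1.le ht.2)) ?_
  intro k
  rw [norm_mul, norm_pow, Real.norm_eq_abs, Real.norm_eq_abs, abs_of_nonneg ht.1.le]
  have := hb k
  have h2 : 0 ≤ t^(k+1) := pow_nonneg ht.1.le _
  nlinarith

lemma bd_aux (n k : ℕ) (c : ℝ) (h0 : 0 ≤ c) (h : c ≤ (k:ℝ)+1) :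
    |c / (((k:ℝ)+1) * Cb n k)| ≤ 1 := by
  have := Cb_pos n k
  have hk : (0:ℝ) ≤ k := Nat.cast_nonneg k
  rw [abs_of_nonneg (by positivity), div_le_one (by positivity)]
  nlinarith

lemma summ_KK (t : ℝ) (ht : t ∈ Set.Ioo (0:ℝ) 1) (n : ℕ) :
    Summable (fun k : ℕ => t ^ (k+1) / (((k:ℝ)+1) * Cb n k)) := by
  refine (summ_bd t ht (fun k => 1 / (((k:ℝ)+1) * Cb n k)) (fun k => bd_aux n k 1 (by norm_num) ?_)).congr ?_
  · linarith [(Nat.cast_nonneg k : (0:ℝ) ≤ k)]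
  · intro k; ring

lemma summ_GG (t : ℝ) (ht : t ∈ Set.Ioo (0:ℝ) 1) (n : ℕ) :
    Summable (fun k : ℕ => H k * t ^ (k+1) / (((k:ℝ)+1) * Cb n k)) := by
  refine (summ_bd t ht (fun k => H k / (((k:ℝ)+1) * Cb n k)) (fun k => bd_aux n k _ (H_nonneg' k) ?_)).congr ?_
  · linarith [H_le' k]
  · intro k; ring

lemma summ_FF (t : ℝ) (ht : t ∈ Set.Ioo (0:ℝ) 1) (n : ℕ) :
    Summable (fun k : ℕ => H k * t ^ (k+1) / (((k:ℝ)+1)^2 * Cb n k)) := by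
  refine (summ_bd t ht (fun k => (H k / ((k:ℝ)+1)) / (((k:ℝ)+1) * Cb n k)) (fun k => bd_aux n k _ ?_ ?_)).congr ?_
  · have := H_nonneg' k
    positivity
  · rw [div_le_iff₀ (by positivity)]
    nlinarith [H_le' k, (Nat.cast_nonneg k : (0:ℝ) ≤ k)]
  · intro k
    have := Cb_pos n k
    field_simp

lemma KK_rec (t : ℝ) (ht : t ∈ Set.Ioo (0:ℝ) 1) (n : ℕ) :
    t * KK t (n+1) = (t-1) * KK t n + t / ((n:ℝ)+1) := by
  have s0 := summ_KK t ht n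
  have s1 := summ_KK t ht (n+1)
  have hz := s0.tsum_eq_zero_add
  have s2 := (summable_nat_add_iff 1).2 s0
  have key : ∑' k : ℕ, t ^ (k+1+1) / ((((k+1:ℕ):ℝ)+1) * Cb n (k+1)) = t * KK t n - t * KK t (n+1) := by
    unfold KK
    rw [← tsum_mul_left, ← tsum_mul_left, ← (s0.mul_left t).tsum_sub (s1.mul_left t)]
    refine tsum_congr fun k => ?_
    have hA := Cb_A n k
    have hD := Cb_D n k
    have p0 := Cb_pos n k
    have p1 := Cb_pos (n+1) k
    have p2 := Cb_pos n (k+1)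
    have e0 : Cb n k = Cb (n+1) k * ((n:ℝ)+1) / ((n:ℝ)+k+2) := by
      rw [eq_div_iff (by positivity)]; exact hA
    have e2 : Cb n (k+1) = Cb (n+1) k * ((n:ℝ)+1) / ((k:ℝ)+2) := by
      rw [eq_div_iff (by positivity)]; exact hD
    rw [e0, e2]
    push_cast
    have : (k:ℝ)+1+1 = k+2 := by ring
    rw [this]
    field_simp
    ring
  have hC : Cb n 0 = (n:ℝ)+1 := by simp [Cb]
  rw [key] at hz
  simp only [hC, Nat.cast_zero, zero_add, pow_one, one_mul] at hz
  have : KK t n = t / ((n:ℝ)+1) + (t * KK t n - t * KK t (n+1)) := hz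
  linarith

lemma GG_rec (t : ℝ) (ht : t ∈ Set.Ioo (0:ℝ) 1) (n : ℕ) :
    t * GG t (n+1) = (t-1) * GG t n + t * KK t (n+1) / ((n:ℝ)+1) := by
  have s0 := summ_GG t ht n
  have s1 := summ_GG t ht (n+1)
  have sK := summ_KK t ht (n+1)
  have hz := s0.tsum_eq_zero_add
  have key : ∑' k : ℕ, H (k+1) * t ^ (k+1+1) / ((((k+1:ℕ):ℝ)+1) * Cb n (k+1)) =
      t * GG t n - t * GG t (n+1) + (t / ((n:ℝ)+1)) * KK t (n+1) := by
    unfold KK GG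
    rw [← tsum_mul_left, ← tsum_mul_left, ← tsum_mul_left, ← (s0.mul_left t).tsum_sub (s1.mul_left t),
      ← ((s0.mul_left t).sub (s1.mul_left t)).tsum_add (sK.mul_left _)]
    refine tsum_congr fun k => ?_
    have hA := Cb_A n k
    have hD := Cb_D n k
    have p0 := Cb_pos n k
    have p1 := Cb_pos (n+1) k
    have p2 := Cb_pos n (k+1)
    have e0 : Cb n k = Cb (n+1) k * ((n:ℝ)+1) / ((n:ℝ)+k+2) := by
      rw [eq_div_iff (by positivity)]; exact hA
    have e2 : Cb n (k+1) = Cb (n+1) k * ((n:ℝ)+1) / ((k:ℝ)+2) := by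
      rw [eq_div_iff (by positivity)]; exact hD
    rw [e0, e2, H_succ']
    push_cast
    have : (k:ℝ)+1+1 = k+2 := by ring
    rw [this]
    field_simp
    ring
  rw [key] at hz
  simp only [H_zero', zero_mul, zero_div, zero_add] at hz
  have : GG t n = t * GG t n - t * GG t (n+1) + (t / ((n:ℝ)+1)) * KK t (n+1) := hz
  linear_combination this

lemma FF_rec (t : ℝ) (ht : t ∈ Set.Ioo (0:ℝ) 1) (n : ℕ) :
    FF t (n+1) = FF t n - GG t (n+1) / ((n:ℝ)+1) := by
  have s0 := summ_FF t ht n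
  have s1 := summ_GG t ht (n+1)
  unfold FF GG
  rw [← tsum_div_const, ← s0.tsum_sub (s1.div_const _)]
  refine tsum_congr fun k => ?_
  have hA := Cb_A n k
  have p1 := Cb_pos (n+1) k
  have e0 : Cb n k = Cb (n+1) k * ((n:ℝ)+1) / ((n:ℝ)+k+2) := by
    rw [eq_div_iff (by positivity)]; exact hA
  rw [e0]
  field_simp
  ring

noncomputable def KR (u : ℝ) (n : ℕ) : ℝ := ∑ p ∈ Finset.range n, u ^ p / ((n:ℝ) - p)
noncomputable def GR (u : ℝ) (n : ℕ) : ℝ :=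
  ∑ p ∈ Finset.range n, u ^ p / ((n:ℝ) - p) * (H n - H (n - p) + 1 / ((n:ℝ) - p))

lemma KR_succ (u : ℝ) (n : ℕ) : KR u (n+1) = u * KR u n + 1 / ((n:ℝ)+1) := by
  unfold KR
  rw [Finset.sum_range_succ', Finset.mul_sum]
  congr 1
  · refine Finset.sum_congr rfl fun p _ => ?_
    push_cast
    rw [add_sub_add_right_eq_sub]
    ring
  · simp

lemma GR_succ (u : ℝ) (n : ℕ) : GR u (n+1) = u * GR u n + KR u (n+1) / ((n:ℝ)+1) := by
  rw [KR_succ]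
  unfold GR KR
  rw [Finset.sum_range_succ', Finset.mul_sum, Finset.mul_sum, add_div, Finset.sum_div, ← add_assoc,
    ← Finset.sum_add_distrib]
  congr 1
  · refine Finset.sum_congr rfl fun p _ => ?_
    push_cast
    rw [add_sub_add_right_eq_sub, H_succ']
    ring
  · simp
    ring

lemma KK_eq (t : ℝ) (ht : t ∈ Set.Ioo (0:ℝ) 1) (n : ℕ) :
    KK t n = ((t-1)/t)^n * (-Real.log (1-t)) + KR ((t-1)/t) n := by
  have hx' : |t| < 1 := abs_lt.2 ⟨by linarith [ht.1], ht.2⟩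
  have h0 : t ≠ 0 := ht.1.ne'
  induction n with
  | zero => simp [KK, KR, Cb_zero, (K0_sum t hx').tsum_eq]
  | succ n ih =>
    have h := KK_rec t ht n
    have h' : KK t (n+1) = ((t-1)/t) * KK t n + 1 / ((n:ℝ)+1) := by
      apply mul_left_cancel₀ h0
      rw [h]; field_simp
    rw [h', ih, KR_succ, pow_succ]; ring

lemma GG_eq (t : ℝ) (ht : t ∈ Set.Ioo (0:ℝ) 1) (n : ℕ) :
    GG t n = ((t-1)/t)^n * (Real.log (1-t)^2/2) - ((t-1)/t)^n * H n * Real.log (1-t)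
      + GR ((t-1)/t) n := by
  have h0 : t ≠ 0 := ht.1.ne'
  induction n with
  | zero => simp [GG, GR, Cb_zero, H_zero', G0_eq t ht]
  | succ n ih =>
    have h := GG_rec t ht n
    have h' : GG t (n+1) = ((t-1)/t) * GG t n + KK t (n+1) / ((n:ℝ)+1) := by
      apply mul_left_cancel₀ h0
      rw [h]; field_simp
    rw [h', ih, GR_succ, KK_eq t ht, pow_succ, H_succ']; ring

noncomputable def PP (u : ℝ) (n : ℕ) : ℝ := ∑ p ∈ Finset.range n,
          (∑ k ∈ Finset.Icc 1 (n - p),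
              ((H (p + k) - H k) / (((p : ℝ) + (k : ℝ)) * (k : ℝ)) +
                1 / ((k : ℝ) ^ 2 * ((p : ℝ) + (k : ℝ))))) * u ^ p

lemma PP_succ (u : ℝ) (n : ℕ) : PP u (n+1) = PP u n + GR u (n+1) / ((n:ℝ)+1) := by
  have e : PP u n = ∑ p ∈ Finset.range (n+1),
          (∑ k ∈ Finset.Icc 1 (n - p),
              ((H (p + k) - H k) / (((p : ℝ) + (k : ℝ)) * (k : ℝ)) +
                1 / ((k : ℝ) ^ 2 * ((p : ℝ) + (k : ℝ))))) * u ^ p := by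
    rw [Finset.sum_range_succ]; simp [PP]
  rw [e]
  unfold PP GR
  rw [Finset.sum_div, ← Finset.sum_add_distrib]
  refine Finset.sum_congr rfl fun p hp => ?_
  have hp' : p ≤ n := by simpa [Nat.lt_succ_iff] using hp
  obtain ⟨m, rfl⟩ := Nat.exists_eq_add_of_le hp'
  have e1 : p + m + 1 - p = m + 1 := by omega
  have e2 : p + m - p = m := by omega
  rw [e1, e2, Finset.sum_Icc_succ_top (by omega)]
  have e3 : p + (m + 1) = p + m + 1 := by omega
  rw [e3]
  push_cast
  have e4 : (p:ℝ) + m + 1 - p = m + 1 := by ring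
  have e5 : (p:ℝ) + (m + 1) = p + m + 1 := by ring
  rw [e4, e5]
  field_simp

lemma FF_eq (t : ℝ) (ht : t ∈ Set.Ioo (0:ℝ) 1) (n : ℕ) :
    FF t n = zeta3 - Li3 (1 - t) -
        1 / 2 * Real.log (1 - t) ^ 2 *
          (∑ k ∈ Finset.Icc 1 n, 1 / (k : ℝ) * ((t - 1) / t) ^ k) +
        (zeta2 - Li2 t) * Real.log (1 - t) +
        Real.log (1 - t) * (∑ k ∈ Finset.Icc 1 n, H k / (k : ℝ) * ((t - 1) / t) ^ k) -
        PP ((t-1)/t) n -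
        1 / 2 * Real.log t * Real.log (1 - t) ^ 2 := by
  induction n with
  | zero =>
    have := F0_eq t ht
    simp only [FF, Cb_zero, mul_one, this]
    simp [PP]
  | succ n ih =>
    rw [FF_rec t ht, ih, GG_eq t ht, PP_succ, Finset.sum_Icc_succ_top (by omega),
      Finset.sum_Icc_succ_top (by omega)]
    push_cast
    ring

/-- For `n` a positive integer and real `0 < t < 1`,
`∑_{k=1}^∞ H_{k-1} t^k/(k² C(n+k,k)) = ζ(3) - Li₃(1-t)
  - (1/2)log²(1-t) ∑_{k=1}^n (1/k)((t-1)/t)^k + (ζ(2)-Li₂(t))log(1-t)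
  + log(1-t) ∑_{k=1}^n (H_k/k)((t-1)/t)^k
  - ∑_{p=0}^{n-1} { ∑_{k=1}^{n-p} ( (H_{p+k}-H_k)/((p+k)k) + 1/(k²(p+k)) ) } ((t-1)/t)^p
  - (1/2)log t log²(1-t)`. -/
theorem harmonic_binom_series_sq (n : ℕ) (hn : 0 < n) (t : ℝ) (ht0 : 0 < t) (ht1 : t < 1) :
    ∑' k : ℕ,
        H k * t ^ (k + 1) / (((k : ℝ) + 1) ^ 2 * (Nat.choose (n + (k + 1)) (k + 1) : ℝ)) =
      zeta3 - Li3 (1 - t) -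
        1 / 2 * Real.log (1 - t) ^ 2 *
          (∑ k ∈ Finset.Icc 1 n, 1 / (k : ℝ) * ((t - 1) / t) ^ k) +
        (zeta2 - Li2 t) * Real.log (1 - t) +
        Real.log (1 - t) * (∑ k ∈ Finset.Icc 1 n, H k / (k : ℝ) * ((t - 1) / t) ^ k) -
        (∑ p ∈ Finset.range n,
          (∑ k ∈ Finset.Icc 1 (n - p),
              ((H (p + k) - H k) / (((p : ℝ) + (k : ℝ)) * (k : ℝ)) +
                1 / ((k : ℝ) ^ 2 * ((p : ℝ) + (k : ℝ))))) * ((t - 1) / t) ^ p) -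
        1 / 2 * Real.log t * Real.log (1 - t) ^ 2 := by
  exact FF_eq t ⟨ht0, ht1⟩ n
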